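/- arXiv:1405.2878 — 2 statements merged into one kernel-verified Lean document; each statement's English description precedes it below -/
import Mathlib

section
/- Let k ≥ 1 and let ε_1,…,ε_k ≥ 0 satisfy ν e_j ≤ ε_j for all 1 ≤ j ≤ k. Then μ(v_{π*} − v_{σ_k}) ≤ (C_{π*}/(1−γ)) Σ_{i=1}^{k} ε_i + γ^k Vmax. -/
open Finset Matrix

noncomputable section

/-- Transition matrix of a deterministic stationary policy. -/
def polMat {S A : Type*} (P : S → A → S → ℝ) (π : S → A) : Matrix S S ℝ :=
  Matrix.of fun s s' => P s (π s) s'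

/-- Bellman operator `T_π v = r + γ P_π v` of a deterministic stationary policy. -/
def bOp {S A : Type*} [Fintype S] (P : S → A → S → ℝ) (γ : ℝ) (r : S → ℝ)
    (π : S → A) (v : S → ℝ) : S → ℝ :=
  fun s => r s + γ * ∑ s' : S, P s (π s) s' * v s'

/-- `errOf P γ r v π = max_{π'} T_{π'} v − T_π v` (componentwise maximum over all
deterministic stationary policies `π'`). -/
def errOf {S A : Type*} [Fintype S] [Fintype A] [DecidableEq S] [Nonempty A]
    (P : S → A → S → ℝ) (γ : ℝ) (r : S → ℝ) (v : S → ℝ) (π : S → A) : S → ℝ :=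
  fun s => (Finset.univ.sup' Finset.univ_nonempty fun π' : S → A => bOp P γ r π' v s)
    - bOp P γ r π v s

/-- Values of the PSDP∞ non-stationary policies: `vSig P γ r πseq k = v_{σ_k}
= T_{π_k} T_{π_{k-1}} ⋯ T_{π_1} r` (so `vSig P γ r πseq 0 = r`). -/
def vSig {S A : Type*} [Fintype S] (P : S → A → S → ℝ) (γ : ℝ) (r : S → ℝ)
    (πseq : ℕ → S → A) : ℕ → S → ℝ
  | 0 => r
  | k+1 => bOp P γ r (πseq (k+1)) (vSig P γ r πseq k)


/-- A vector solving `m = μ + γ m Q` with `μ ≥ 0` and `Q` row-stochastic is nonnegative. -/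
theorem nonneg_of_eq_add_discounted {S : Type*} [Fintype S] (Q : S → S → ℝ)
    (hQ0 : ∀ s t, 0 ≤ Q s t) (hQ1 : ∀ s, ∑ t, Q s t = 1)
    (γ : ℝ) (hγ0 : 0 < γ) (hγ1 : γ < 1) (μ m : S → ℝ) (hμ0 : ∀ s, 0 ≤ μ s)
    (hm : ∀ s, m s = μ s + γ * ∑ t, m t * Q t s) (s : S) : 0 ≤ m s := by
  have hn0 : ∀ t, 0 ≤ max (-m t) 0 := fun t => le_max_right _ _
  have hstep : ∀ t, max (-m t) 0 ≤ γ * ∑ u, max (-m u) 0 * Q u t := by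
    intro t
    apply max_le
    · have h : ∑ u, -(m u * Q u t) ≤ ∑ u, max (-m u) 0 * Q u t := by
        refine Finset.sum_le_sum fun u _ => ?_
        rw [← neg_mul]
        exact mul_le_mul_of_nonneg_right (le_max_left _ _) (hQ0 u t)
      rw [Finset.sum_neg_distrib] at h
      have := mul_le_mul_of_nonneg_left h hγ0.le
      linarith [hm t, hμ0 t]
    · exact mul_nonneg hγ0.le (Finset.sum_nonneg fun u _ => mul_nonneg (hn0 u) (hQ0 u t))
  have htotal : ∑ t, max (-m t) 0 ≤ γ * ∑ u, max (-m u) 0 := by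
    calc ∑ t, max (-m t) 0 ≤ ∑ t, γ * ∑ u, max (-m u) 0 * Q u t :=
          Finset.sum_le_sum fun t _ => hstep t
      _ = γ * ∑ u, max (-m u) 0 := by
          rw [← Finset.mul_sum, Finset.sum_comm]
          simp_rw [← Finset.mul_sum, hQ1, mul_one]
  have hsingle : max (-m s) 0 ≤ ∑ t, max (-m t) 0 :=
    Finset.single_le_sum (f := fun t => max (-m t) 0) (fun t _ => hn0 t) (Finset.mem_univ s)
  have hneg : -m s ≤ max (-m s) 0 := le_max_left _ _
  nlinarith [hn0 s]

/-- `I - γ Q` is invertible when `Q` is row-stochastic and `0 < γ < 1`. -/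
theorem isUnit_det_one_sub_smul {S : Type*} [Fintype S] [DecidableEq S] (Q : Matrix S S ℝ)
    (hQ0 : ∀ s t, 0 ≤ Q s t) (hQ1 : ∀ s, ∑ t, Q s t = 1)
    (γ : ℝ) (hγ0 : 0 < γ) (hγ1 : γ < 1) : IsUnit (1 - γ • Q).det := by
  refine isUnit_iff_ne_zero.mpr (det_ne_zero_of_sum_row_lt_diag fun s => ?_)
  have hoff : ∑ t ∈ Finset.univ.erase s, ‖(1 - γ • Q) s t‖
      = γ * ∑ t ∈ Finset.univ.erase s, Q s t := by
    rw [Finset.mul_sum]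
    refine Finset.sum_congr rfl fun t ht => ?_
    simp [Matrix.one_apply_ne (Finset.ne_of_mem_erase ht).symm, abs_of_pos hγ0,
      abs_of_nonneg (hQ0 s t)]
  have hsplit := Finset.add_sum_erase Finset.univ (fun t => Q s t) (Finset.mem_univ s)
  rw [hQ1 s] at hsplit
  refine lt_of_lt_of_le ?_ (le_abs_self _)
  rw [hoff, Matrix.sub_apply, Matrix.one_apply_eq, Matrix.smul_apply, smul_eq_mul]
  nlinarith

/-- The discounted occupation vector `m = μ (I - γ Q)⁻¹` satisfies `m = μ + γ m Q`. -/
theorem vecMul_inv_eq_add {S : Type*} [Fintype S] [DecidableEq S] (Q : Matrix S S ℝ)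
    (γ : ℝ) (h : IsUnit (1 - γ • Q).det) (μ : S → ℝ) (s : S) :
    Matrix.vecMul μ (1 - γ • Q)⁻¹ s
      = μ s + γ * ∑ t, Matrix.vecMul μ (1 - γ • Q)⁻¹ t * Q t s := by
  have key : Matrix.vecMul (Matrix.vecMul μ (1 - γ • Q)⁻¹) (1 - γ • Q) = μ := by
    rw [Matrix.vecMul_vecMul, Matrix.nonsing_inv_mul _ h, Matrix.vecMul_one]
  rw [Matrix.vecMul_sub, Matrix.vecMul_one, Matrix.vecMul_smul] at key
  have := congrFun key s
  simp only [Pi.sub_apply, Pi.smul_apply, smul_eq_mul] at this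
  change _ - γ * ∑ t, Matrix.vecMul μ (1 - γ • Q)⁻¹ t * Q t s = μ s at this
  linarith

/-- A fixed point of `T_π` is bounded above by `Rmax / (1 - γ)`. -/
theorem le_div_of_bOp_eq {S A : Type*} [Fintype S] (P : S → A → S → ℝ)
    (hP0 : ∀ s a s', 0 ≤ P s a s') (hP1 : ∀ s a, ∑ s' : S, P s a s' = 1)
    (γ : ℝ) (hγ0 : 0 < γ) (hγ1 : γ < 1) (Rmax : ℝ) (r : S → ℝ) (hr : ∀ s, r s ≤ Rmax)
    (π : S → A) (v : S → ℝ) (hv : bOp P γ r π v = v) (s : S) : v s ≤ Rmax / (1 - γ) := by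
  have : Nonempty S := ⟨s⟩
  obtain ⟨s₀, hs₀⟩ := Finite.exists_max v
  refine (hs₀ s).trans ?_
  rw [le_div_iff₀ (by linarith)]
  have hsum : ∑ t, P s₀ (π s₀) t * v t ≤ v s₀ := by
    calc ∑ t, P s₀ (π s₀) t * v t ≤ ∑ t, P s₀ (π s₀) t * v s₀ :=
          Finset.sum_le_sum fun t _ => mul_le_mul_of_nonneg_left (hs₀ t) (hP0 _ _ _)
      _ = v s₀ := by rw [← Finset.sum_mul, hP1, one_mul]
  have heq : r s₀ + γ * ∑ t, P s₀ (π s₀) t * v t = v s₀ := congrFun hv s₀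
  nlinarith [hr s₀]

theorem bOp_sub_bOp_le_errOf {S A : Type*} [Fintype S] [Fintype A] [DecidableEq S] [Nonempty A]
    (P : S → A → S → ℝ) (γ : ℝ) (r v : S → ℝ) (π π' : S → A) (s : S) :
    bOp P γ r π' v s - bOp P γ r π v s ≤ errOf P γ r v π s :=
  sub_le_sub_right
    (Finset.le_sup' (fun π' : S → A => bOp P γ r π' v s) (Finset.mem_univ π')) _

theorem errOf_nonneg {S A : Type*} [Fintype S] [Fintype A] [DecidableEq S] [Nonempty A]
    (P : S → A → S → ℝ) (γ : ℝ) (r v : S → ℝ) (π : S → A) (s : S) :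
    0 ≤ errOf P γ r v π s := by
  simpa using bOp_sub_bOp_le_errOf P γ r v π π s

/-- if `ν e_j ≤ ε_j` for `1 ≤ j ≤ k`, then
`μ(v_{π*} − v_{σ_k}) ≤ (C_{π*}/(1−γ)) Σ_{i=1}^{k} ε_i + γ^k Vmax`, where `C_{π*}` satisfies
`d_{π*,μ} = (1−γ)μ(I−γP_{π*})^{−1} ≤ C_{π*} ν` componentwise. -/
theorem stmt3
    {S A : Type*} [Fintype S] [Fintype A] [DecidableEq S] [Nonempty S] [Nonempty A]
    (P : S → A → S → ℝ) (hP0 : ∀ s a s', 0 ≤ P s a s')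
    (hP1 : ∀ s a, ∑ s' : S, P s a s' = 1)
    (γ : ℝ) (hγ0 : 0 < γ) (hγ1 : γ < 1)
    (Rmax Vmax : ℝ) (r : S → ℝ) (hr : ∀ s, |r s| ≤ Rmax)
    (hVmax : Vmax = Rmax / (1 - γ))
    (πstar : S → A) (vstar : S → ℝ)
    (hfix : bOp P γ r πstar vstar = vstar)
    (hopt : ∀ (π : S → A) (v : S → ℝ), bOp P γ r π v = v → ∀ s, v s ≤ vstar s)
    (μ ν : S → ℝ) (hμ0 : ∀ s, 0 ≤ μ s) (hμ1 : ∑ s : S, μ s = 1)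
    (hν0 : ∀ s, 0 ≤ ν s) (hν1 : ∑ s : S, ν s = 1)
    (Cπ : ℝ) (hCπ0 : 0 ≤ Cπ)
    (hCπ : ∀ s, ((1 - γ) • Matrix.vecMul μ (1 - γ • polMat P πstar)⁻¹) s ≤ Cπ * ν s)
    (πseq : ℕ → S → A) (k : ℕ) (hk : 1 ≤ k)
    (εf : ℕ → ℝ) (hεf0 : ∀ j, 0 ≤ εf j)
    (herr : ∀ j, 1 ≤ j → j ≤ k →
      (∑ s : S, ν s * errOf P γ r (vSig P γ r πseq (j - 1)) (πseq j) s) ≤ εf j) :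
    (∑ s : S, μ s * (vstar s - vSig P γ r πseq k s)) ≤
      Cπ / (1 - γ) * (∑ i ∈ Finset.Icc 1 k, εf i) + γ ^ k * Vmax := by
  have hQ0 : ∀ s t, 0 ≤ polMat P πstar s t := fun s t => hP0 _ _ _
  have hQ1 : ∀ s, ∑ t, polMat P πstar s t = 1 := fun s => hP1 _ _
  have h1γ : 0 < 1 - γ := by linarith
  have hm := vecMul_inv_eq_add (polMat P πstar) γ
    (isUnit_det_one_sub_smul _ hQ0 hQ1 γ hγ0 hγ1) μ
  have hmC : ∀ s, Matrix.vecMul μ (1 - γ • polMat P πstar)⁻¹ s ≤ Cπ / (1 - γ) * ν s := by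
    intro s
    have h := hCπ s
    rw [Pi.smul_apply, smul_eq_mul] at h
    rw [div_mul_eq_mul_div, le_div_iff₀ h1γ]
    linarith
  generalize Matrix.vecMul μ (1 - γ • polMat P πstar)⁻¹ = m at hm hmC
  have hm0 := nonneg_of_eq_add_discounted _ hQ0 hQ1 γ hγ0 hγ1 μ m hμ0 hm
  have hD0 : 0 ≤ Cπ / (1 - γ) := div_nonneg hCπ0 h1γ.le
  have hV0 : 0 ≤ Vmax := by
    obtain ⟨s⟩ := ‹Nonempty S›
    exact hVmax ▸ div_nonneg ((abs_nonneg _).trans (hr s)) h1γ.le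
  have hvV : ∀ s, vstar s ≤ Vmax := fun s => hVmax ▸
    le_div_of_bOp_eq P hP0 hP1 γ hγ0 hγ1 Rmax r (fun s => (le_abs_self _).trans (hr s))
      πstar vstar hfix s
  have hfix' : ∀ s, r s + γ * ∑ t, polMat P πstar s t * vstar t = vstar s :=
    fun s => congrFun hfix s
  have main : ∀ n, n ≤ k → ∀ w : S → ℝ, (∀ s, 0 ≤ w s) → (∀ s, w s ≤ m s) →
      ∑ s, w s * (vstar s - vSig P γ r πseq n s) ≤
        Cπ / (1 - γ) * (∑ i ∈ Finset.Icc 1 n, εf i) + γ ^ n * Vmax * ∑ s, w s := by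
    intro n
    induction n with
    | zero =>
      intro _ w hw0 _
      have hbase : ∀ s, vstar s - r s ≤ Vmax := by
        intro s
        have hsum : ∑ t, polMat P πstar s t * vstar t ≤ Vmax := by
          calc ∑ t, polMat P πstar s t * vstar t ≤ ∑ t, polMat P πstar s t * Vmax :=
                Finset.sum_le_sum fun t _ => mul_le_mul_of_nonneg_left (hvV t) (hQ0 _ _)
            _ = Vmax := by rw [← Finset.sum_mul, hQ1, one_mul]
        nlinarith [hfix' s]
      calc ∑ s, w s * (vstar s - vSig P γ r πseq 0 s) ≤ ∑ s, w s * Vmax :=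
            Finset.sum_le_sum fun s _ => mul_le_mul_of_nonneg_left (hbase s) (hw0 s)
        _ = _ := by simp [← Finset.mul_sum, mul_comm]
    | succ n ih =>
      intro hn w hw0 hwm
      set x := vSig P γ r πseq n with hx
      set e := errOf P γ r x (πseq (n + 1)) with he
      have he0 : ∀ s, 0 ≤ e s := errOf_nonneg P γ r x _
      have hw'0 : ∀ t, 0 ≤ γ * ∑ s, w s * polMat P πstar s t := fun t =>
        mul_nonneg hγ0.le (Finset.sum_nonneg fun s _ => mul_nonneg (hw0 s) (hQ0 s t))
      have hw'm : ∀ t, γ * ∑ s, w s * polMat P πstar s t ≤ m t := by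
        intro t
        have h : ∑ s, w s * polMat P πstar s t ≤ ∑ s, m s * polMat P πstar s t :=
          Finset.sum_le_sum fun s _ => mul_le_mul_of_nonneg_right (hwm s) (hQ0 s t)
        have := mul_le_mul_of_nonneg_left h hγ0.le
        linarith [hm t, hμ0 t]
      have hih := ih (by omega) (fun t => γ * ∑ s, w s * polMat P πstar s t) hw'0 hw'm
      have hmass : ∑ t, γ * ∑ s, w s * polMat P πstar s t = γ * ∑ s, w s := by
        rw [← Finset.mul_sum, Finset.sum_comm]
        simp_rw [← Finset.mul_sum, hQ1, mul_one]
      have hshift : ∑ t, (γ * ∑ s, w s * polMat P πstar s t) * (vstar t - x t)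
          = ∑ s, w s * (γ * ∑ t, polMat P πstar s t * (vstar t - x t)) := by
        simp_rw [Finset.mul_sum, Finset.sum_mul]
        rw [Finset.sum_comm]
        exact Finset.sum_congr rfl fun s _ => Finset.sum_congr rfl fun t _ => by ring
      have hpt : ∀ s, vstar s - vSig P γ r πseq (n + 1) s
          ≤ γ * ∑ t, polMat P πstar s t * (vstar t - x t) + e s := by
        intro s
        have h : r s + γ * ∑ t, polMat P πstar s t * x t - vSig P γ r πseq (n + 1) s ≤ e s :=
          bOp_sub_bOp_le_errOf P γ r x (πseq (n + 1)) πstar s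
        simp_rw [mul_sub, Finset.sum_sub_distrib]
        linarith [hfix' s]
      have herr' : ∑ s, w s * e s ≤ Cπ / (1 - γ) * εf (n + 1) := by
        calc ∑ s, w s * e s ≤ ∑ s, Cπ / (1 - γ) * (ν s * e s) :=
              Finset.sum_le_sum fun s _ => by
                rw [← mul_assoc]
                exact mul_le_mul_of_nonneg_right ((hwm s).trans (hmC s)) (he0 s)
          _ = Cπ / (1 - γ) * ∑ s, ν s * e s := by rw [Finset.mul_sum]
          _ ≤ _ := mul_le_mul_of_nonneg_left (herr (n + 1) (by omega) hn) hD0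
      calc ∑ s, w s * (vstar s - vSig P γ r πseq (n + 1) s)
          ≤ ∑ s, w s * (γ * ∑ t, polMat P πstar s t * (vstar t - x t) + e s) :=
            Finset.sum_le_sum fun s _ => mul_le_mul_of_nonneg_left (hpt s) (hw0 s)
        _ = ∑ t, (γ * ∑ s, w s * polMat P πstar s t) * (vstar t - x t) + ∑ s, w s * e s := by
            rw [hshift, ← Finset.sum_add_distrib]
            exact Finset.sum_congr rfl fun s _ => mul_add _ _ _
        _ ≤ (Cπ / (1 - γ) * (∑ i ∈ Finset.Icc 1 n, εf i) + γ ^ n * Vmax * (γ * ∑ s, w s))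
            + Cπ / (1 - γ) * εf (n + 1) := add_le_add (hmass ▸ hih) herr'
        _ = _ := by
            rw [Finset.sum_Icc_succ_top (by omega), pow_succ]
            ring
  have hμm : ∀ s, μ s ≤ m s := fun s => by
    have : 0 ≤ γ * ∑ t, m t * polMat P πstar t s :=
      mul_nonneg hγ0.le (Finset.sum_nonneg fun t _ => mul_nonneg (hm0 t) (hQ0 t s))
    linarith [hm s]
  simpa [hμ1] using main k le_rfl μ hμ0 hμm
end
end

section
/- Let ε ∈ (0, 2Vmax] and suppose ν e_j ≤ ε for all j ≥ 1, and that C^{(1)}_{π*} := (1−γ) Σ_{i=0}^∞ γ^i c_{π*}(i) is finite. For every integer k ≥ 1 with k ≥ log(2Vmax/ε)/(1−γ), let w_k : S → ℝ be the unique fixed point of the γ^k-contraction T_{π_k} ∘ T_{π_{k−1}} ∘ ⋯ ∘ T_{π_1} (the value of the infinite-horizon policy (σ_k)^∞ that loops over σ_k). Then μ(v_{π*} − w_k) ≤ (C^{(1)}_{π*}/(1−γ)) ε + ε. -/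
open Finset Matrix

noncomputable section

/-- The composed operator `psRun P γ r πseq k = T_{π_k} ∘ T_{π_{k−1}} ∘ ⋯ ∘ T_{π_1}`
(the identity for `k = 0`). -/
def psRun {S A : Type*} [Fintype S] (P : S → A → S → ℝ) (γ : ℝ) (r : S → ℝ)
    (πseq : ℕ → S → A) : ℕ → (S → ℝ) → (S → ℝ)
  | 0, v => v
  | k+1, v => bOp P γ r (πseq (k+1)) (psRun P γ r πseq k v)

theorem bOp_le_add {S A : Type*} [Fintype S] {P : S → A → S → ℝ}
    (hP0 : ∀ s a s', 0 ≤ P s a s') (hP1 : ∀ s a, ∑ s' : S, P s a s' = 1)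
    {γ : ℝ} (hγ0 : 0 ≤ γ) (r : S → ℝ) (π : S → A) {v v' : S → ℝ} {d : ℝ}
    (h : ∀ s, v s ≤ v' s + d) (s : S) :
    bOp P γ r π v s ≤ bOp P γ r π v' s + γ * d := by
  have h1 : ∑ s', P s (π s) s' * v s' ≤ ∑ s', P s (π s) s' * (v' s' + d) :=
    Finset.sum_le_sum fun s' _ => mul_le_mul_of_nonneg_left (h s') (hP0 _ _ _)
  simp only [mul_add, Finset.sum_add_distrib, ← Finset.sum_mul, hP1, one_mul] at h1
  have h2 := mul_le_mul_of_nonneg_left h1 hγ0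
  simp only [bOp]
  linarith

theorem psRun_le_add {S A : Type*} [Fintype S] {P : S → A → S → ℝ}
    (hP0 : ∀ s a s', 0 ≤ P s a s') (hP1 : ∀ s a, ∑ s' : S, P s a s' = 1)
    {γ : ℝ} (hγ0 : 0 ≤ γ) (r : S → ℝ) (πseq : ℕ → S → A) {v v' : S → ℝ} {d : ℝ}
    (h : ∀ s, v s ≤ v' s + d) (k : ℕ) (s : S) :
    psRun P γ r πseq k v s ≤ psRun P γ r πseq k v' s + γ ^ k * d := by
  induction k generalizing s with
  | zero => simpa [psRun] using h s
  | succ k ih =>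
    have := bOp_le_add hP0 hP1 hγ0 r (πseq (k + 1)) ih s
    simp only [psRun]
    rwa [pow_succ', mul_assoc]

theorem vSig_eq_psRun {S A : Type*} [Fintype S] (P : S → A → S → ℝ) (γ : ℝ) (r : S → ℝ)
    (πseq : ℕ → S → A) (k : ℕ) : vSig P γ r πseq k = psRun P γ r πseq k r := by
  induction k with
  | zero => rfl
  | succ k ih => simp only [vSig, psRun, ih]

theorem abs_bOp_le {S A : Type*} [Fintype S] {P : S → A → S → ℝ}
    (hP0 : ∀ s a s', 0 ≤ P s a s') (hP1 : ∀ s a, ∑ s' : S, P s a s' = 1)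
    {γ : ℝ} (hγ0 : 0 ≤ γ) {r : S → ℝ} {R : ℝ} (hr : ∀ s, |r s| ≤ R)
    (π : S → A) {v : S → ℝ} {b : ℝ} (hv : ∀ s, |v s| ≤ b) (s : S) :
    |bOp P γ r π v s| ≤ R + γ * b := by
  have h1 : |∑ s', P s (π s) s' * v s'| ≤ b := by
    calc |∑ s', P s (π s) s' * v s'| ≤ ∑ s', |P s (π s) s' * v s'| :=
          Finset.abs_sum_le_sum_abs _ _
      _ ≤ ∑ s', P s (π s) s' * b := Finset.sum_le_sum fun s' _ => by
          rw [abs_mul, abs_of_nonneg (hP0 _ _ _)]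
          exact mul_le_mul_of_nonneg_left (hv s') (hP0 _ _ _)
      _ = b := by rw [← Finset.sum_mul, hP1, one_mul]
  calc |bOp P γ r π v s| ≤ |r s| + |γ * ∑ s', P s (π s) s' * v s'| := abs_add_le _ _
    _ ≤ R + γ * b := by
      rw [abs_mul, abs_of_nonneg hγ0]
      exact add_le_add (hr s) (mul_le_mul_of_nonneg_left h1 hγ0)

theorem abs_psRun_le {S A : Type*} [Fintype S] {P : S → A → S → ℝ}
    (hP0 : ∀ s a s', 0 ≤ P s a s') (hP1 : ∀ s a, ∑ s' : S, P s a s' = 1)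
    {γ : ℝ} (hγ0 : 0 ≤ γ) {r : S → ℝ} {V : ℝ} (hr : ∀ s, |r s| ≤ (1 - γ) * V)
    (πseq : ℕ → S → A) {v : S → ℝ} {d : ℝ} (hv : ∀ s, |v s| ≤ V + d) (k : ℕ) (s : S) :
    |psRun P γ r πseq k v s| ≤ V + γ ^ k * d := by
  induction k generalizing s with
  | zero => simpa [psRun] using hv s
  | succ k ih =>
    refine (abs_bOp_le hP0 hP1 hγ0 hr (πseq (k + 1)) ih s).trans_eq ?_
    ring

theorem abs_le_of_psRun_eq_self {S A : Type*} [Fintype S] [Nonempty S] {P : S → A → S → ℝ}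
    (hP0 : ∀ s a s', 0 ≤ P s a s') (hP1 : ∀ s a, ∑ s' : S, P s a s' = 1)
    {γ : ℝ} (hγ0 : 0 ≤ γ) (hγ1 : γ < 1) {r : S → ℝ} {V : ℝ}
    (hr : ∀ s, |r s| ≤ (1 - γ) * V) (πseq : ℕ → S → A) {k : ℕ} (hk : k ≠ 0) {w : S → ℝ}
    (hw : psRun P γ r πseq k w = w) (s : S) : |w s| ≤ V := by
  obtain ⟨s₀, hs₀⟩ := Finite.exists_max fun s => |w s|
  have h := abs_psRun_le hP0 hP1 hγ0 hr πseq (v := w) (d := |w s₀| - V)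
    (fun s => by linarith [hs₀ s]) k s₀
  rw [hw] at h
  have hpow : γ ^ k < 1 := pow_lt_one₀ hγ0 hγ1 hk
  have : |w s₀| ≤ V := by
    by_contra! hlt
    nlinarith
  exact (hs₀ s).trans this

theorem bOp_le_bOp_add_errOf {S A : Type*} [Fintype S] [Fintype A] [DecidableEq S] [Nonempty A]
    (P : S → A → S → ℝ) (γ : ℝ) (r v : S → ℝ) (π π' : S → A) (s : S) :
    bOp P γ r π' v s ≤ bOp P γ r π v s + errOf P γ r v π s := by
  have := Finset.le_sup' (fun π' : S → A => bOp P γ r π' v s) (Finset.mem_univ π')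
  simp only [errOf]
  linarith

theorem vecMul_polMat_pow_nonneg {S A : Type*} [Fintype S] [DecidableEq S] {P : S → A → S → ℝ}
    (hP0 : ∀ s a s', 0 ≤ P s a s') (π : S → A) {μ : S → ℝ} (hμ0 : ∀ s, 0 ≤ μ s)
    (i : ℕ) (s : S) : 0 ≤ Matrix.vecMul μ (polMat P π ^ i) s := by
  induction i generalizing s with
  | zero => simpa using hμ0 s
  | succ i ih =>
    rw [pow_succ, ← Matrix.vecMul_vecMul]
    exact Finset.sum_nonneg fun s' _ => mul_nonneg (ih s') (hP0 _ _ _)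

theorem sum_vecMul_polMat_pow_succ_mul {S A : Type*} [Fintype S] [DecidableEq S]
    (P : S → A → S → ℝ) (π : S → A) (μ : S → ℝ) (i : ℕ) (x : S → ℝ) :
    ∑ s, Matrix.vecMul μ (polMat P π ^ (i + 1)) s * x s =
      ∑ s, Matrix.vecMul μ (polMat P π ^ i) s * ∑ s', P s (π s) s' * x s' := by
  rw [pow_succ, ← Matrix.vecMul_vecMul]
  exact (Matrix.dotProduct_mulVec _ (polMat P π) x).symm

theorem sum_vecMul_polMat_pow {S A : Type*} [Fintype S] [DecidableEq S] {P : S → A → S → ℝ}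
    (hP1 : ∀ s a, ∑ s' : S, P s a s' = 1) (π : S → A) {μ : S → ℝ} (hμ1 : ∑ s, μ s = 1)
    (i : ℕ) : ∑ s, Matrix.vecMul μ (polMat P π ^ i) s = 1 := by
  induction i with
  | zero => simpa using hμ1
  | succ i ih =>
    have := sum_vecMul_polMat_pow_succ_mul P π μ i fun _ => 1
    simpa only [mul_one, hP1, ih] using this

theorem sum_vecMul_mul_sub_vSig_le {S A : Type*} [Fintype S] [Fintype A] [DecidableEq S]
    [Nonempty A] {P : S → A → S → ℝ} (hP0 : ∀ s a s', 0 ≤ P s a s')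
    (hP1 : ∀ s a, ∑ s' : S, P s a s' = 1) {γ : ℝ} (hγ0 : 0 ≤ γ) {r : S → ℝ}
    {πstar : S → A} {vstar : S → ℝ} (hfix : bOp P γ r πstar vstar = vstar)
    {V : ℝ} (hV : ∀ s, vstar s ≤ V) {μ ν : S → ℝ} (hμ0 : ∀ s, 0 ≤ μ s)
    (hμ1 : ∑ s : S, μ s = 1) {c : ℕ → ℝ} (hc0 : ∀ i, 0 ≤ c i)
    (hc : ∀ (i : ℕ) (s : S), Matrix.vecMul μ (polMat P πstar ^ i) s ≤ c i * ν s)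
    {πseq : ℕ → S → A} {ε : ℝ}
    (herr : ∀ j, ∑ s : S, ν s * errOf P γ r (vSig P γ r πseq j) (πseq (j + 1)) s ≤ ε)
    (k i : ℕ) :
    ∑ s, Matrix.vecMul μ (polMat P πstar ^ i) s * (vstar s - vSig P γ r πseq k s) ≤
      (∑ j ∈ Finset.range k, γ ^ j * c (i + j)) * ε + γ ^ (k + 1) * V := by
  have hm := vecMul_polMat_pow_nonneg hP0 πstar hμ0
  induction k generalizing i with
  | zero =>
    have hle : ∀ s, vstar s - vSig P γ r πseq 0 s ≤ γ * V := fun s => by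
      have h := bOp_le_add hP0 hP1 hγ0 r πstar (v := vstar) (v' := 0) (d := V)
        (fun s => by simpa using hV s) s
      rw [hfix] at h
      simp only [bOp, Pi.zero_apply, mul_zero, Finset.sum_const_zero, add_zero] at h
      simp only [vSig]
      linarith
    calc _ ≤ ∑ s, Matrix.vecMul μ (polMat P πstar ^ i) s * (γ * V) :=
          Finset.sum_le_sum fun s _ => mul_le_mul_of_nonneg_left (hle s) (hm i s)
      _ = _ := by rw [← Finset.sum_mul, sum_vecMul_polMat_pow hP1 πstar hμ1]; simp
  | succ k ih =>
    set e := errOf P γ r (vSig P γ r πseq k) (πseq (k + 1)) with he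
    have hstep : ∀ s, vstar s - vSig P γ r πseq (k + 1) s ≤
        γ * ∑ s', P s (πstar s) s' * (vstar s' - vSig P γ r πseq k s') + e s := fun s => by
      have h1 := bOp_le_bOp_add_errOf P γ r (vSig P γ r πseq k) (πseq (k + 1)) πstar s
      have h2 := congrFun hfix s
      simp only [mul_sub, Finset.sum_sub_distrib]
      simp only [vSig, he]
      simp only [bOp] at h1 h2 ⊢
      linarith
    have herr' : ∑ s, Matrix.vecMul μ (polMat P πstar ^ i) s * e s ≤ c i * ε :=
      calc _ ≤ ∑ s, c i * ν s * e s := Finset.sum_le_sum fun s _ =>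
            mul_le_mul_of_nonneg_right (hc i s) (errOf_nonneg P γ r _ _ s)
        _ = c i * ∑ s, ν s * e s := by simp only [Finset.mul_sum, mul_assoc]
        _ ≤ c i * ε := mul_le_mul_of_nonneg_left (herr k) (hc0 i)
    have hrec := mul_le_mul_of_nonneg_left (ih (i + 1)) hγ0
    rw [sum_vecMul_polMat_pow_succ_mul] at hrec
    calc _ ≤ ∑ s, Matrix.vecMul μ (polMat P πstar ^ i) s *
            (γ * ∑ s', P s (πstar s) s' * (vstar s' - vSig P γ r πseq k s') + e s) :=
          Finset.sum_le_sum fun s _ => mul_le_mul_of_nonneg_left (hstep s) (hm i s)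
      _ = γ * (∑ s, Matrix.vecMul μ (polMat P πstar ^ i) s *
            ∑ s', P s (πstar s) s' * (vstar s' - vSig P γ r πseq k s')) +
            ∑ s, Matrix.vecMul μ (polMat P πstar ^ i) s * e s := by
          rw [Finset.mul_sum, ← Finset.sum_add_distrib]
          exact Finset.sum_congr rfl fun s _ => by ring
      _ ≤ _ := add_le_add hrec herr'
      _ = _ := by
          have hsplit : ∑ j ∈ Finset.range (k + 1), γ ^ j * c (i + j) =
              γ * (∑ j ∈ Finset.range k, γ ^ j * c (i + 1 + j)) + c i := by
            rw [Finset.sum_range_succ', Finset.mul_sum]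
            refine congrArg₂ (· + ·) (Finset.sum_congr rfl fun j _ => ?_) (by simp)
            rw [add_assoc i 1 j, add_comm 1 j, pow_succ']
            ring
          rw [hsplit]
          ring

theorem pow_mul_le_of_log_div_le {γ b ε : ℝ} (hγ0 : 0 ≤ γ) (hγ1 : γ < 1) (hε : 0 < ε)
    (hb : 0 < b) {k : ℕ} (hk : Real.log (b / ε) / (1 - γ) ≤ k) : γ ^ k * b ≤ ε := by
  have hγ : γ ≤ Real.exp (-(1 - γ)) := by linarith [Real.add_one_le_exp (-(1 - γ))]
  have hpow : γ ^ k ≤ Real.exp (-Real.log (b / ε)) := by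
    refine (pow_le_pow_left₀ hγ0 hγ k).trans ?_
    rw [← Real.exp_nat_mul]
    rw [div_le_iff₀ (by linarith)] at hk
    exact Real.exp_le_exp.2 (by linarith)
  rw [Real.exp_neg, Real.exp_log (div_pos hb hε), inv_div, le_div_iff₀ hb] at hpow
  exact hpow

/-- if `ν e_j ≤ ε` for all `j ≥ 1`, `ε ∈ (0, 2Vmax]` and
`C^{(1)}_{π*} = (1−γ)Σ_i γ^i c_{π*}(i)` is finite, then for every `k ≥ 1` with
`k ≥ log(2Vmax/ε)/(1−γ)`, the fixed point `w_k` of `T_{π_k} ∘ ⋯ ∘ T_{π_1}`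
(the value of the policy that loops over `σ_k`) satisfies
`μ(v_{π*} − w_k) ≤ (C^{(1)}_{π*}/(1−γ)) ε + ε`. -/
theorem stmt4
    {S A : Type*} [Fintype S] [Fintype A] [DecidableEq S] [Nonempty S] [Nonempty A]
    (P : S → A → S → ℝ) (hP0 : ∀ s a s', 0 ≤ P s a s')
    (hP1 : ∀ s a, ∑ s' : S, P s a s' = 1)
    (γ : ℝ) (hγ0 : 0 < γ) (hγ1 : γ < 1)
    (Rmax Vmax : ℝ) (r : S → ℝ) (hr : ∀ s, |r s| ≤ Rmax)
    (hVmax : Vmax = Rmax / (1 - γ))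
    (πstar : S → A) (vstar : S → ℝ)
    (hfix : bOp P γ r πstar vstar = vstar)
    (hopt : ∀ (π : S → A) (v : S → ℝ), bOp P γ r π v = v → ∀ s, v s ≤ vstar s)
    (μ ν : S → ℝ) (hμ0 : ∀ s, 0 ≤ μ s) (hμ1 : ∑ s : S, μ s = 1)
    (hν0 : ∀ s, 0 ≤ ν s) (hν1 : ∑ s : S, ν s = 1)
    (cπ : ℕ → ℝ) (hcπ0 : ∀ i, 0 ≤ cπ i)
    (hcπ : ∀ (i : ℕ) (s : S), Matrix.vecMul μ ((polMat P πstar) ^ i) s ≤ cπ i * ν s)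
    (hsum : Summable fun i : ℕ => γ ^ i * cπ i)
    (πseq : ℕ → S → A)
    (ε : ℝ) (hε0 : 0 < ε) (hε1 : ε ≤ 2 * Vmax)
    (herr : ∀ j, 1 ≤ j →
      (∑ s : S, ν s * errOf P γ r (vSig P γ r πseq (j - 1)) (πseq j) s) ≤ ε)
    (k : ℕ) (hk : 1 ≤ k) (hk2 : Real.log (2 * Vmax / ε) / (1 - γ) ≤ (k : ℝ))
    (w : S → ℝ) (hw : psRun P γ r πseq k w = w) :
    (∑ s : S, μ s * (vstar s - w s)) ≤
      ((1 - γ) * ∑' i : ℕ, γ ^ i * cπ i) / (1 - γ) * ε + ε := by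
  have h1γ : 0 < 1 - γ := by linarith
  have hV0 : 0 < 2 * Vmax := hε0.trans_le hε1
  have hR : Rmax = (1 - γ) * Vmax := by rw [hVmax]; field_simp
  have hr' : ∀ s, |r s| ≤ (1 - γ) * Vmax := fun s => hR ▸ hr s
  have hstar : ∀ s, vstar s ≤ Vmax := fun s => (le_abs_self _).trans
    (abs_le_of_psRun_eq_self hP0 hP1 hγ0.le hγ1 hr' (fun _ => πstar) one_ne_zero hfix s)
  have hwV := abs_le_of_psRun_eq_self hP0 hP1 hγ0.le hγ1 hr' πseq (by omega) hw
  have hdiff : ∀ s, vSig P γ r πseq k s ≤ w s + γ ^ k * ((1 - γ) * Vmax + Vmax) := fun s => by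
    have h := psRun_le_add hP0 hP1 hγ0.le r πseq (v := r) (v' := w)
      (d := (1 - γ) * Vmax + Vmax)
      (fun s => by linarith [(abs_le.1 (hr' s)).2, (abs_le.1 (hwV s)).1]) k s
    rwa [hw, ← vSig_eq_psRun] at h
  have hpsdp := sum_vecMul_mul_sub_vSig_le hP0 hP1 hγ0.le hfix hstar hμ0 hμ1 hcπ0 hcπ
    (fun j => herr (j + 1) (Nat.le_add_left 1 j)) k 0
  simp only [pow_zero, Matrix.vecMul_one, zero_add] at hpsdp
  have hloop : ∑ s, μ s * (vstar s - w s) ≤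
      ∑ s, μ s * (vstar s - vSig P γ r πseq k s) + γ ^ k * ((1 - γ) * Vmax + Vmax) :=
    calc _ ≤ ∑ s, μ s * (vstar s - vSig P γ r πseq k s + γ ^ k * ((1 - γ) * Vmax + Vmax)) :=
          Finset.sum_le_sum fun s _ =>
            mul_le_mul_of_nonneg_left (by linarith [hdiff s]) (hμ0 s)
      _ = _ := by simp only [mul_add, Finset.sum_add_distrib, ← Finset.sum_mul, hμ1, one_mul]
  have htsum := mul_le_mul_of_nonneg_right (hsum.sum_le_tsum (Finset.range k)
    fun i _ => mul_nonneg (pow_nonneg hγ0.le i) (hcπ0 i)) hε0.le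
  have hpow := pow_mul_le_of_log_div_le hγ0.le hγ1 hε0 hV0 hk2
  rw [mul_div_cancel_left₀ _ h1γ.ne']
  rw [pow_succ] at hpsdp
  linarith
end
end
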